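/- In the generalized Weyl algebra A = k⟨x,y,z | xz = σ(z)x, yz = σ⁻¹(z)y, yx = p(z), xy = σ(p)(z)⟩ over a polynomial ring k[z] with automorphism σ and polynomial p of degree ≥ 1, the set {y^k z^i x^j : k,i,j ∈ ℕ, kj = 0} is a k-linear basis of A. -/

import Mathlib

open Polynomial

noncomputable section

variable (K : Type*) [Field K]

/-- The defining relations of the generalized Weyl algebra determined by an
automorphism `σ` of `K[z]` and a polynomial `p`. -/
inductive GWARel (σ : K[X] ≃ₐ[K] K[X]) (p : K[X]) :
    FreeAlgebra K (Fin 3) → FreeAlgebra K (Fin 3) → Prop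
  | xz : GWARel σ p (FreeAlgebra.ι K 0 * FreeAlgebra.ι K 2)
      (aeval (FreeAlgebra.ι K 2) (σ X) * FreeAlgebra.ι K 0)
  | yz : GWARel σ p (FreeAlgebra.ι K 1 * FreeAlgebra.ι K 2)
      (aeval (FreeAlgebra.ι K 2) (σ.symm X) * FreeAlgebra.ι K 1)
  | yx : GWARel σ p (FreeAlgebra.ι K 1 * FreeAlgebra.ι K 0)
      (aeval (FreeAlgebra.ι K 2) p)
  | xy : GWARel σ p (FreeAlgebra.ι K 0 * FreeAlgebra.ι K 1)
      (aeval (FreeAlgebra.ι K 2) (σ p))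

/-- The generalized Weyl algebra `K⟨x,y,z | xz = σ(z)x, yz = σ⁻¹(z)y, yx = p, xy = σ(p)⟩`. -/
abbrev GWA (σ : K[X] ≃ₐ[K] K[X]) (p : K[X]) := RingQuot (GWARel K σ p)

variable {K}

def GWA.x (σ : K[X] ≃ₐ[K] K[X]) (p : K[X]) : GWA K σ p :=
  RingQuot.mkAlgHom K _ (FreeAlgebra.ι K 0)
def GWA.y (σ : K[X] ≃ₐ[K] K[X]) (p : K[X]) : GWA K σ p :=
  RingQuot.mkAlgHom K _ (FreeAlgebra.ι K 1)
def GWA.z (σ : K[X] ≃ₐ[K] K[X]) (p : K[X]) : GWA K σ p :=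
  RingQuot.mkAlgHom K _ (FreeAlgebra.ι K 2)

namespace GWA

section aux
variable (σ : K[X] ≃ₐ[K] K[X]) (p : K[X])

/-- The polynomial subalgebra. -/
def Zm : K[X] →ₐ[K] GWA K σ p := aeval (GWA.z σ p)

theorem Zm_X : Zm σ p X = GWA.z σ p := by simp [Zm]

theorem mk_aeval (f : K[X]) :
    RingQuot.mkAlgHom K (GWARel K σ p) (aeval (FreeAlgebra.ι K 2) f) = Zm σ p f := by
  rw [Zm, GWA.z, ← Polynomial.aeval_algHom_apply]

theorem xz_rel : GWA.x σ p * GWA.z σ p = Zm σ p (σ X) * GWA.x σ p := by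
  have h := RingQuot.mkAlgHom_rel K (GWARel.xz (σ := σ) (p := p))
  rwa [map_mul, map_mul, mk_aeval] at h

theorem yz_rel : GWA.y σ p * GWA.z σ p = Zm σ p (σ.symm X) * GWA.y σ p := by
  have h := RingQuot.mkAlgHom_rel K (GWARel.yz (σ := σ) (p := p))
  rwa [map_mul, map_mul, mk_aeval] at h

theorem yx_rel : GWA.y σ p * GWA.x σ p = Zm σ p p := by
  have h := RingQuot.mkAlgHom_rel K (GWARel.yx (σ := σ) (p := p))
  rwa [map_mul, mk_aeval] at h

theorem xy_rel : GWA.x σ p * GWA.y σ p = Zm σ p (σ p) := by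
  have h := RingQuot.mkAlgHom_rel K (GWARel.xy (σ := σ) (p := p))
  rwa [map_mul, mk_aeval] at h

theorem comm_gen (τ : K[X] ≃ₐ[K] K[X]) (a : GWA K σ p)
    (h : a * GWA.z σ p = Zm σ p (τ X) * a) (f : K[X]) :
    a * Zm σ p f = Zm σ p (τ f) * a := by
  induction f using Polynomial.induction_on' with
  | add f g hf hg => simp only [map_add, mul_add, add_mul, hf, hg]
  | monomial n r =>
    rw [← Polynomial.C_mul_X_pow_eq_monomial]
    induction n with
    | zero =>
      have : (C r * X ^ 0 : K[X]) = algebraMap K K[X] r := by simp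
      rw [this, AlgEquiv.commutes, AlgHom.commutes, Algebra.commutes]
    | succ n ih =>
      rw [pow_succ, ← mul_assoc, map_mul (Zm σ p) _ X, map_mul τ _ X, map_mul (Zm σ p) _ (τ X),
        ← mul_assoc, ih, mul_assoc, Zm_X, h, mul_assoc]

theorem x_comm (f : K[X]) : GWA.x σ p * Zm σ p f = Zm σ p (σ f) * GWA.x σ p :=
  comm_gen σ p σ _ (xz_rel σ p) f

theorem y_comm (f : K[X]) : GWA.y σ p * Zm σ p f = Zm σ p (σ.symm f) * GWA.y σ p :=
  comm_gen σ p σ.symm _ (yz_rel σ p) f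

theorem ypow_comm (k : ℕ) (f : K[X]) :
    ∃ g, Zm σ p f * GWA.y σ p ^ k = GWA.y σ p ^ k * Zm σ p g := by
  induction k generalizing f with
  | zero => exact ⟨f, by simp⟩
  | succ k ih =>
    obtain ⟨g, hg⟩ := ih (σ f)
    refine ⟨g, ?_⟩
    have := y_comm σ p (σ f)
    rw [AlgEquiv.symm_apply_apply] at this
    rw [pow_succ', ← mul_assoc, ← this, mul_assoc, hg, mul_assoc]

/-- The span of the normal words. -/
def S : Submodule K (GWA K σ p) :=
  Submodule.span K (Set.range (fun t : {t : ℕ × ℕ × ℕ // t.1 * t.2.2 = 0} =>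
      GWA.y σ p ^ t.1.1 * GWA.z σ p ^ t.1.2.1 * GWA.x σ p ^ t.1.2.2))

theorem mem_S (k j : ℕ) (h : k * j = 0) (f : K[X]) :
    GWA.y σ p ^ k * Zm σ p f * GWA.x σ p ^ j ∈ S σ p := by
  induction f using Polynomial.induction_on' with
  | add f g hf hg =>
    rw [map_add, mul_add, add_mul]
    exact add_mem hf hg
  | monomial n r =>
    rw [← Polynomial.smul_X_eq_monomial, map_smul, mul_smul_comm, smul_mul_assoc, map_pow, Zm_X]
    exact Submodule.smul_mem _ _ (Submodule.subset_span ⟨⟨(k, n, j), h⟩, rfl⟩)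

theorem S_closed (a : GWA K σ p)
    (h : ∀ (k j : ℕ) (_ : k * j = 0) (f : K[X]),
      a * (GWA.y σ p ^ k * Zm σ p f * GWA.x σ p ^ j) ∈ S σ p) :
    ∀ s ∈ S σ p, a * s ∈ S σ p := by
  intro s hs
  induction hs using Submodule.span_induction with
  | mem s hs =>
    obtain ⟨⟨⟨k, n, j⟩, ht⟩, rfl⟩ := hs
    have := h k j ht (X ^ n)
    rwa [map_pow, Zm_X] at this
  | zero => rw [mul_zero]; exact zero_mem _
  | add s t _ _ hs ht => rw [mul_add]; exact add_mem hs ht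
  | smul r s _ hs => rw [mul_smul_comm]; exact Submodule.smul_mem _ _ hs

theorem z_closed (g : K[X]) : ∀ s ∈ S σ p, Zm σ p g * s ∈ S σ p := by
  apply S_closed
  intro k j h f
  obtain ⟨g', hg⟩ := ypow_comm σ p k g
  rw [← mul_assoc, ← mul_assoc, hg, mul_assoc (_ ^ k), ← map_mul]
  exact mem_S σ p k j h _

theorem x_closed : ∀ s ∈ S σ p, GWA.x σ p * s ∈ S σ p := by
  apply S_closed
  intro k j h f
  rcases k with _ | k
  · rw [pow_zero, one_mul, ← mul_assoc, x_comm, mul_assoc, ← pow_succ']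
    simpa using mem_S σ p 0 (j + 1) (by simp) (σ f)
  · rw [pow_succ', ← mul_assoc, ← mul_assoc, ← mul_assoc, xy_rel, mul_assoc, mul_assoc,
      ← mul_assoc (_ ^ k)]
    refine z_closed σ p _ _ (mem_S σ p k j ?_ f)
    have : j = 0 := by simpa using h
    simp [this]

theorem y_closed : ∀ s ∈ S σ p, GWA.y σ p * s ∈ S σ p := by
  apply S_closed
  intro k j h f
  rcases j with _ | j
  · rw [← mul_assoc, ← mul_assoc, ← pow_succ']
    exact mem_S σ p (k + 1) 0 (by simp) f
  · have : k = 0 := by simpa using h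
    subst this
    rw [pow_zero, one_mul, ← mul_assoc, y_comm, pow_succ', mul_assoc, ← mul_assoc (GWA.y σ p),
      yx_rel, ← mul_assoc, ← map_mul]
    simpa using mem_S σ p 0 j (by simp) (σ.symm f * p)

theorem all_closed (a : FreeAlgebra K (Fin 3)) :
    ∀ s ∈ S σ p, RingQuot.mkAlgHom K (GWARel K σ p) a * s ∈ S σ p := by
  induction a using FreeAlgebra.induction with
  | grade0 r =>
    intro s hs
    rw [AlgHom.commutes, ← Algebra.smul_def]
    exact Submodule.smul_mem _ _ hs
  | grade1 i =>
    fin_cases i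
    · exact x_closed σ p
    · exact y_closed σ p
    · have := z_closed σ p X
      rwa [Zm_X] at this
  | mul a b ha hb =>
    intro s hs
    rw [map_mul, mul_assoc]
    exact ha _ (hb _ hs)
  | add a b ha hb =>
    intro s hs
    rw [map_add, add_mul]
    exact add_mem (ha _ hs) (hb _ hs)

theorem S_top : S σ p = ⊤ := by
  rw [eq_top_iff]
  intro a _
  obtain ⟨b, rfl⟩ := RingQuot.mkAlgHom_surjective K (GWARel K σ p) a
  have h1 : (1 : GWA K σ p) ∈ S σ p := by simpa using mem_S σ p 0 0 (by simp) 1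
  simpa using all_closed σ p b 1 h1

/-! The faithful representation. -/

/-- The shift operator attached to a linear map. -/
def shiftOp (d : ℤ) (L : K[X] →ₗ[K] K[X]) : Module.End K (ℤ →₀ K[X]) :=
  Finsupp.lsum K (fun n : ℤ => Finsupp.lsingle (n + d) ∘ₗ L)

theorem shiftOp_single (d : ℤ) (L : K[X] →ₗ[K] K[X]) (n : ℤ) (f : K[X]) :
    shiftOp d L (Finsupp.single n f) = Finsupp.single (n + d) (L f) := by
  simp [shiftOp]

/-- The linear map by which `y` acts on coefficients. -/
def Ly : K[X] →ₗ[K] K[X] := LinearMap.mulLeft K p ∘ₗ σ.symm.toLinearMap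

theorem Ly_apply (f : K[X]) : Ly σ p f = p * σ.symm f := rfl

/-- The images of the generators. -/
def gens : Fin 3 → Module.End K (ℤ →₀ K[X]) :=
  ![shiftOp 1 σ.toLinearMap, shiftOp (-1) (Ly σ p), Algebra.lsmul K K (ℤ →₀ K[X]) (X : K[X])]

theorem aeval_lsmul (f : K[X]) :
    aeval (Algebra.lsmul K K (ℤ →₀ K[X]) (X : K[X])) f = Algebra.lsmul K K (ℤ →₀ K[X]) f := by
  rw [Polynomial.aeval_algHom_apply, Polynomial.aeval_X_left_apply]

theorem lift_aeval (f : K[X]) :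
    FreeAlgebra.lift K (gens σ p) (aeval (FreeAlgebra.ι K 2) f) =
      Algebra.lsmul K K (ℤ →₀ K[X]) f := by
  rw [← Polynomial.aeval_algHom_apply, FreeAlgebra.lift_ι_apply, ← aeval_lsmul]
  rfl

/-- The representation. -/
def rep : GWA K σ p →ₐ[K] Module.End K (ℤ →₀ K[X]) :=
  RingQuot.liftAlgHom K ⟨FreeAlgebra.lift K (gens σ p), by
    intro a b h
    cases h <;>
    · simp only [map_mul, lift_aeval, FreeAlgebra.lift_ι_apply]
      refine Finsupp.lhom_ext fun n f => ?_
      simp [gens, shiftOp_single, Ly_apply, mul_left_comm, -Finsupp.single_mul]⟩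

theorem rep_x : rep σ p (GWA.x σ p) = shiftOp 1 σ.toLinearMap := by
  simp [rep, GWA.x, gens]

theorem rep_y : rep σ p (GWA.y σ p) = shiftOp (-1) (Ly σ p) := by
  simp [rep, GWA.y, gens]

theorem rep_z : rep σ p (GWA.z σ p) = Algebra.lsmul K K (ℤ →₀ K[X]) (X : K[X]) := by
  simp [rep, GWA.z, gens]

theorem x_pow_act (j : ℕ) :
    (shiftOp 1 σ.toLinearMap ^ j) (Finsupp.single 0 1) = Finsupp.single (j : ℤ) (1 : K[X]) := by
  induction j with
  | zero => simp
  | succ j ih => rw [pow_succ', Module.End.mul_apply, ih, shiftOp_single]; simp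

theorem y_pow_act (k : ℕ) (n : ℤ) (f : K[X]) :
    (shiftOp (-1) (Ly σ p) ^ k) (Finsupp.single n f) =
      Finsupp.single (n - k) ((Ly σ p ^ k) f) := by
  induction k with
  | zero => simp
  | succ k ih =>
    rw [pow_succ', Module.End.mul_apply, ih, shiftOp_single, pow_succ', Module.End.mul_apply]
    congr 1
    push_cast
    ring

theorem word_act (k i j : ℕ) :
    rep σ p (GWA.y σ p ^ k * GWA.z σ p ^ i * GWA.x σ p ^ j) (Finsupp.single 0 1) =
      Finsupp.single ((j : ℤ) - k) ((Ly σ p ^ k) (X ^ i)) := by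
  rw [map_mul, map_mul, map_pow, map_pow, map_pow, rep_x, rep_y, rep_z, ← map_pow,
    Module.End.mul_apply, Module.End.mul_apply, x_pow_act]
  rw [Algebra.lsmul_coe]
  beta_reduce
  rw [Finsupp.smul_single, y_pow_act, smul_eq_mul, mul_one]

theorem Ly_pow_inj (hp : p ≠ 0) (k : ℕ) : Function.Injective (Ly σ p ^ k) := by
  rw [Module.End.coe_pow]
  apply Function.Injective.iterate
  intro f g h
  rw [Ly_apply, Ly_apply] at h
  exact σ.symm.injective (mul_left_cancel₀ hp h)

theorem indep (hp : p ≠ 0) :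
    LinearIndependent K (fun t : {t : ℕ × ℕ × ℕ // t.1 * t.2.2 = 0} =>
      GWA.y σ p ^ t.1.1 * GWA.z σ p ^ t.1.2.1 * GWA.x σ p ^ t.1.2.2) := by
  apply LinearIndependent.of_comp
    ((LinearMap.applyₗ (Finsupp.single (0 : ℤ) (1 : K[X]))) ∘ₗ (rep σ p).toLinearMap)
  have hX : LinearIndependent K (fun i : ℕ => (X ^ i : K[X])) := by
    have := (Polynomial.basisMonomials K).linearIndependent
    rw [Polynomial.coe_basisMonomials] at this
    simpa only [Polynomial.monomial_one_right_eq_X_pow] using this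
  have h := Finsupp.linearIndependent_single (R := K)
    (fun (n : ℤ) (i : ℕ) => (Ly σ p ^ (-n).toNat) (X ^ i : K[X]))
    (fun n => hX.map' _ (LinearMap.ker_eq_bot.2 (Ly_pow_inj σ p hp _)))
  have key (k j : ℕ) (h : k * j = 0) : (-((j : ℤ) - k)).toNat = k := by
    rcases Nat.mul_eq_zero.1 h with h | h <;> subst h <;> omega
  have h2 := h.comp (fun t : {t : ℕ × ℕ × ℕ // t.1 * t.2.2 = 0} =>
    (⟨(t.1.2.2 : ℤ) - t.1.1, t.1.2.1⟩ : Σ _ : ℤ, ℕ)) (by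
      rintro ⟨⟨k, i, j⟩, h⟩ ⟨⟨k', i', j'⟩, h'⟩ e
      simp only [Sigma.mk.injEq, heq_eq_eq] at e
      obtain ⟨e1, rfl⟩ := e
      have a := key k j h
      have b := key k' j' h'
      rw [e1] at a
      have : k = k' := a.symm.trans b
      subst this
      have : j = j' := by omega
      subst this
      rfl)
  refine Eq.mp (congrArg (fun v => LinearIndependent K v) (funext fun t => ?_)) h2
  obtain ⟨⟨k, i, j⟩, h⟩ := t
  have e := word_act σ p k i j
  simp only [Function.comp_apply, LinearMap.comp_apply, LinearMap.applyₗ_apply_apply,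
    AlgHom.toLinearMap_apply, key k j h]
  exact e.symm

end aux

end GWA

/-- In the generalized Weyl algebra
`A = k⟨x,y,z | xz = σ(z)x, yz = σ⁻¹(z)y, yx = p(z), xy = σ(p)(z)⟩` over `k[z]` with
`σ(z) = qz + c`, `q ≠ 0`, and `deg p ≥ 1`, the set `{y^k z^i x^j : kj = 0}` is a
`k`-linear basis of `A`. -/
theorem gwa_basis (σ : K[X] ≃ₐ[K] K[X]) (p : K[X]) (q c : K) (hq : q ≠ 0)
    (hσ : σ X = C q * X + C c) (hp : 1 ≤ p.natDegree) :
    LinearIndependent K (fun t : {t : ℕ × ℕ × ℕ // t.1 * t.2.2 = 0} =>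
      GWA.y σ p ^ t.1.1 * GWA.z σ p ^ t.1.2.1 * GWA.x σ p ^ t.1.2.2) ∧
    Submodule.span K (Set.range (fun t : {t : ℕ × ℕ × ℕ // t.1 * t.2.2 = 0} =>
      GWA.y σ p ^ t.1.1 * GWA.z σ p ^ t.1.2.1 * GWA.x σ p ^ t.1.2.2)) = ⊤ := by
  exact ⟨GWA.indep σ p (by rintro rfl; simp at hp), GWA.S_top σ p⟩
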